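/- Fix α > 0 and K ∈ ℕ. Then for every N ∈ ℕ with N ≥ 1/α and N ≥ 2K+1 there exists a K-bandlimited function f on the circle with sup_t |f(t)| ≤ α (one may take f constant equal to 1/(2N)) such that for every choice of bits q ∈ {−1,1}^N, the reconstruction f_q(t) = (1/N) Σ_{n=0}^{N−1} q_n φ^K(t − 2πn/N) satisfies sup_t |f(t) − f_q(t)| ≥ 1/(2N). -/

import Mathlib

noncomputable section
open Real
open scoped Classical

/-- The Dirichlet kernel `φᴷ`. -/
def dirichlet (K : ℕ) (x : ℝ) : ℝ :=
  if ∃ m : ℤ, x = 2 * π * m then 2 * K + 1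
  else Real.sin ((2 * K + 1) * x / 2) / Real.sin (x / 2)

/-- `f : ℝ → ℝ` is `K`-bandlimited on the circle. -/
def KBandlimited (K : ℕ) (f : ℝ → ℝ) : Prop :=
  ∃ c : ℤ → ℂ, ∀ t : ℝ, (f t : ℂ) =
    ∑ ξ ∈ Finset.Icc (-(K : ℤ)) (K : ℤ), c ξ * Complex.exp (Complex.I * ξ * t)

/-- The Dirichlet kernel is the trigonometric polynomial `1 + 2 ∑ cos (k x)`, `1 ≤ k ≤ K`. -/
theorem dirichlet_eq_sum_cos (K : ℕ) (x : ℝ) :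
    dirichlet K x = 1 + 2 * ∑ k ∈ Finset.range K, Real.cos ((k + 1) * x) := by
  unfold dirichlet
  split_ifs with h
  · obtain ⟨m, rfl⟩ := h
    have hcos : ∀ k ∈ Finset.range K, Real.cos (((k : ℝ) + 1) * (2 * π * m)) = 1 := by
      intro k _
      rw [Real.cos_eq_one_iff]
      exact ⟨(k + 1) * m, by push_cast; ring⟩
    rw [Finset.sum_congr rfl hcos]
    simp
    ring
  · have hs : Real.sin (x / 2) ≠ 0 := by
      intro h0
      obtain ⟨m, hm⟩ := Real.sin_eq_zero_iff.mp h0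
      exact h ⟨m, by linarith⟩
    rw [div_eq_iff hs]
    clear h hs
    induction K with
    | zero => simp
    | succ K ih =>
      have hsub := Real.sin_sub_sin ((2 * (K + 1 : ℝ) + 1) * x / 2) ((2 * K + 1) * x / 2)
      rw [show ((2 * (K + 1 : ℝ) + 1) * x / 2 - (2 * K + 1) * x / 2) / 2 = x / 2 by ring,
        show ((2 * (K + 1 : ℝ) + 1) * x / 2 + (2 * K + 1) * x / 2) / 2 = (K + 1) * x by ring]
        at hsub
      rw [Finset.sum_range_succ]
      push_cast
      linear_combination ih + hsub

theorem continuous_dirichlet (K : ℕ) : Continuous (dirichlet K) := by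
  rw [funext (dirichlet_eq_sum_cos K)]
  fun_prop

theorem abs_dirichlet_le (K : ℕ) (x : ℝ) : |dirichlet K x| ≤ 1 + 2 * K := by
  have hsum : |∑ k ∈ Finset.range K, Real.cos (((k : ℝ) + 1) * x)| ≤ K := by
    refine (Finset.abs_sum_le_sum_abs _ _).trans ?_
    refine (Finset.sum_le_sum fun k _ => Real.abs_cos_le_one _).trans ?_
    simp
  rw [dirichlet_eq_sum_cos]
  rw [abs_le] at hsum ⊢
  constructor <;> linarith [hsum.1, hsum.2]

theorem integral_dirichlet_sub (K : ℕ) (a : ℝ) :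
    ∫ t in (0 : ℝ)..2 * π, dirichlet K (t - a) = 2 * π := by
  have hcos : ∀ k ∈ Finset.range K,
      ∫ t in (0 : ℝ)..2 * π, Real.cos (((k : ℝ) + 1) * (t - a)) = 0 := by
    intro k _
    have hk : (k : ℝ) + 1 ≠ 0 := by positivity
    simp_rw [mul_sub]
    rw [intervalIntegral.integral_comp_mul_sub (fun y => Real.cos y) hk, integral_cos]
    have hper := Real.sin_add_nat_mul_two_pi (((k : ℝ) + 1) * 0 - (k + 1) * a) (k + 1)
    rw [show ((k : ℝ) + 1) * (2 * π) - (k + 1) * a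
      = ((k : ℝ) + 1) * 0 - (k + 1) * a + ((k + 1 : ℕ) : ℝ) * (2 * π) by push_cast; ring, hper]
    simp
  simp_rw [dirichlet_eq_sum_cos]
  rw [intervalIntegral.integral_add (by simp)
      (Continuous.intervalIntegrable (by fun_prop) _ _),
    intervalIntegral.integral_const_mul, intervalIntegral.integral_finsetSum
      (fun k _ => Continuous.intervalIntegrable (by fun_prop) _ _), Finset.sum_congr rfl hcos]
  simp

/-- A constant function is bandlimited. -/
theorem kBandlimited_const (K : ℕ) (c : ℝ) : KBandlimited K fun _ => c := by
  refine ⟨fun ξ => if ξ = 0 then (c : ℂ) else 0, fun t => ?_⟩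
  rw [Finset.sum_eq_single (0 : ℤ)]
  · simp
  · intro ξ _ hξ
    simp [hξ]
  · intro h0
    simp at h0

theorem exists_int_sum_signs (q : ℕ → ℝ) (N : ℕ) (hq : ∀ n < N, q n = 1 ∨ q n = -1) :
    ∃ s : ℤ, ∑ n ∈ Finset.range N, q n = s := by
  induction N with
  | zero => exact ⟨0, by simp⟩
  | succ N ih =>
    obtain ⟨s, hs⟩ := ih fun n hn => hq n (by omega)
    rw [Finset.sum_range_succ, hs]
    rcases hq N (by omega) with h1 | h1
    · exact ⟨s + 1, by rw [h1]; push_cast; ring⟩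
    · exact ⟨s - 1, by rw [h1]; push_cast; ring⟩

theorem half_le_abs_half_sub_int (s : ℤ) : 1 / 2 ≤ |1 / 2 - (s : ℝ)| := by
  rcases le_or_gt s 0 with h | h
  · have hs : (s : ℝ) ≤ 0 := by exact_mod_cast h
    exact le_trans (by linarith) (le_abs_self _)
  · have hs : (1 : ℝ) ≤ s := by exact_mod_cast h
    exact le_trans (by linarith) (neg_le_abs _)

/-- **A lower bound for one-bit reconstruction on the circle.**
Fix `α > 0` and `K`.  For every `N ≥ 1/α` with `N ≥ 2K+1` there is a
`K`-bandlimited `f` with `supₜ |f(t)| ≤ α` (one may take `f ≡ 1/(2N)`) such that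
for every bit sequence `q ∈ {-1,1}ᴺ` the reconstruction
`f_q(t) = (1/N) ∑ₙ qₙ φᴷ(t - 2πn/N)` satisfies `supₜ |f(t) - f_q(t)| ≥ 1/(2N)`. -/
theorem one_bit_lower_bound (α : ℝ) (hα : 0 < α) (K N : ℕ)
    (hN1 : 1 / α ≤ (N : ℝ)) (hN2 : 2 * K + 1 ≤ N) :
    ∃ f : ℝ → ℝ, KBandlimited K f ∧ (∀ t : ℝ, |f t| ≤ α) ∧
      ∀ q : ℕ → ℝ, (∀ n < N, q n = 1 ∨ q n = -1) →
        1 / (2 * N) ≤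
          ⨆ t : ℝ, |f t - (1 / N) * ∑ n ∈ Finset.range N,
            q n * dirichlet K (t - 2 * π * n / N)| := by
  have hN : (0 : ℝ) < N := by
    have : 0 < N := by omega
    exact_mod_cast this
  have hαN : 1 / (2 * (N : ℝ)) ≤ α := by
    rw [div_le_iff₀ hα] at hN1
    rw [div_le_iff₀ (by positivity)]
    nlinarith
  refine ⟨fun _ => 1 / (2 * N), kBandlimited_const K _, fun _ => ?_, fun q hq => ?_⟩
  · rwa [abs_of_nonneg (by positivity)]
  obtain ⟨s, hs⟩ := exists_int_sum_signs q N hq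
  set g : ℝ → ℝ := fun t => 1 / (2 * N) - (1 / N) * ∑ n ∈ Finset.range N,
    q n * dirichlet K (t - 2 * π * n / N) with hg
  have hbdd : BddAbove (Set.range fun t => |g t|) := by
    refine ⟨1 / (2 * N) + (1 / N) * ∑ n ∈ Finset.range N, |q n| * (1 + 2 * K), ?_⟩
    rintro _ ⟨t, rfl⟩
    refine (abs_sub _ _).trans ?_
    rw [abs_mul, abs_of_nonneg (by positivity : (0 : ℝ) ≤ 1 / (2 * N)),
      abs_of_nonneg (by positivity : (0 : ℝ) ≤ 1 / N)]
    gcongr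
    refine (Finset.abs_sum_le_sum_abs _ _).trans (Finset.sum_le_sum fun n _ => ?_)
    rw [abs_mul]
    gcongr
    exact abs_dirichlet_le K _
  have hcont := continuous_dirichlet K
  have hint : ∫ t in (0 : ℝ)..2 * π, g t = 2 * π * ((1 / 2 - s) / N) := by
    rw [hg, intervalIntegral.integral_sub (by simp)
        (Continuous.intervalIntegrable (by fun_prop) _ _),
      intervalIntegral.integral_const_mul, intervalIntegral.integral_finsetSum
        (fun n _ => Continuous.intervalIntegrable (by fun_prop) _ _)]
    simp_rw [intervalIntegral.integral_const_mul, integral_dirichlet_sub]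
    rw [← Finset.sum_mul, hs, intervalIntegral.integral_const, smul_eq_mul]
    field_simp
    ring
  have hle : ‖∫ t in (0 : ℝ)..2 * π, g t‖ ≤ (⨆ t : ℝ, |g t|) * |2 * π - 0| :=
    intervalIntegral.norm_integral_le_of_norm_le_const fun t _ => le_ciSup hbdd t
  rw [hint, sub_zero, Real.norm_eq_abs, abs_mul, mul_comm, abs_div, abs_of_pos hN] at hle
  calc 1 / (2 * (N : ℝ)) = 1 / 2 / N := by rw [div_div]
    _ ≤ |1 / 2 - (s : ℝ)| / N := by
      gcongr
      exact half_le_abs_half_sub_int s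
    _ ≤ ⨆ t : ℝ, |g t| := le_of_mul_le_mul_right hle (by positivity)
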